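/- For a complexified octonion z = (x, y) ∈ 𝕆_ℂ (standing for x + i·y with x, y ∈ 𝕆), one has z • conj(z) = conj(z) • z = ((‖x‖² − ‖y‖²) • 1, (2⟨x,y⟩) • 1), where ‖x‖² := N(x), ⟨x,y⟩ is the Euclidean inner product ⟨(a,b),(c,d)⟩ := (a * star c).re + (b * star d).re on 𝕆 ≅ ℝ⁸, and 1 = (1,0) is the octonion unit. -/

import Mathlib

noncomputable section

/-- The quaternions over ℝ. -/
abbrev ℍ := Quaternion ℝ

/-- The octonions, modeled as Cayley–Dickson pairs of quaternions. -/
abbrev 𝕆 := ℍ × ℍ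

/-- Cayley–Dickson multiplication on 𝕆 = ℍ × ℍ. -/
def omul (x y : 𝕆) : 𝕆 :=
  (x.1 * y.1 - star y.2 * x.2, x.2 * star y.1 + y.2 * x.1)

/-- Octonionic conjugation on 𝕆 = ℍ × ℍ. -/
def oconj (x : 𝕆) : 𝕆 := (star x.1, -x.2)


/-- The unit octonion. -/
def oone : 𝕆 := (1, 0)

/-- The squared Euclidean norm on 𝕆 = ℍ × ℍ. -/
def N (x : 𝕆) : ℝ := ‖x.1‖ ^ 2 + ‖x.2‖ ^ 2

/-- The Euclidean inner product on 𝕆 ≅ ℝ⁸. -/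
def oinner (x y : 𝕆) : ℝ := (x.1 * star y.1).re + (x.2 * star y.2).re

/-- The complexified octonions 𝕆_ℂ, modeled as pairs `(x, y)` standing for `x + i·y`. -/
abbrev 𝕆ℂ := 𝕆 × 𝕆

/-- Multiplication in 𝕆_ℂ. -/
def cmul (z w : 𝕆ℂ) : 𝕆ℂ :=
  (omul z.1 w.1 - omul z.2 w.2, omul z.1 w.2 + omul z.2 w.1)

/-- Octonionic conjugation on 𝕆_ℂ. -/
def cconj (z : 𝕆ℂ) : 𝕆ℂ := (oconj z.1, oconj z.2)

theorem N_eq_oinner_self (x : 𝕆) : N x = oinner x x := by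
  simp only [N, oinner, Quaternion.self_mul_star, Quaternion.re_coe,
    Quaternion.normSq_eq_norm_mul_self, sq]

theorem omul_oconj_add_omul_oconj (x y : 𝕆) :
    omul x (oconj y) + omul y (oconj x) = (2 * oinner x y) • oone := by
  ext <;> simp [omul, oconj, oinner, oone, Quaternion.re_one, Quaternion.imI_one,
    Quaternion.imJ_one, Quaternion.imK_one] <;> ring

theorem oconj_omul_add_oconj_omul (x y : 𝕆) :
    omul (oconj x) y + omul (oconj y) x = (2 * oinner x y) • oone := by
  ext <;> simp [omul, oconj, oinner, oone, Quaternion.re_one, Quaternion.imI_one,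
    Quaternion.imJ_one, Quaternion.imK_one] <;> ring

theorem omul_oconj_self (x : 𝕆) : omul x (oconj x) = N x • oone := by
  have h := omul_oconj_add_omul_oconj x x
  rw [← two_smul ℝ, mul_smul, ← N_eq_oinner_self] at h
  exact smul_right_injective 𝕆 (two_ne_zero' ℝ) h

theorem oconj_omul_self (x : 𝕆) : omul (oconj x) x = N x • oone := by
  have h := oconj_omul_add_oconj_omul x x
  rw [← two_smul ℝ, mul_smul, ← N_eq_oinner_self] at h
  exact smul_right_injective 𝕆 (two_ne_zero' ℝ) h

/-- For `z = x + i y ∈ 𝕆_ℂ` one has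
`z conj(z) = conj(z) z = (‖x‖² − ‖y‖²) + i·(2⟨x,y⟩)` (as scalar multiples of 1). -/
theorem cmul_cconj (z : 𝕆ℂ) :
    cmul z (cconj z) = ((N z.1 - N z.2) • oone, (2 * oinner z.1 z.2) • oone) ∧
    cmul (cconj z) z = ((N z.1 - N z.2) • oone, (2 * oinner z.1 z.2) • oone) := by
  constructor
  · simp only [cmul, cconj, omul_oconj_self, omul_oconj_add_omul_oconj, sub_smul]
  · simp only [cmul, cconj, oconj_omul_self, oconj_omul_add_oconj_omul, sub_smul]
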